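/- For every w ∈ A0_xy and every w' ∈ A−_xy: (q−1)·[i]·(F0·F−)_{w,x} = q^{i+1}·[k−i]·((F0)²)_{w',x}, and (q−1)·[i]·((F−)²)_{w,x} = q^{i+1}·[k−i]·(F0·F−)_{w',x}. -/

import Mathlib

open scoped Classical

noncomputable section

variable {F V : Type} [Field F] [AddCommGroup V] [Module F V]

/-- `v` covers `u` in the projective geometry `P`. -/
def Covers (u v : Submodule F V) : Prop :=
  u ≤ v ∧ Module.finrank F ↥v = Module.finrank F ↥u + 1

/-- `v` slash-covers `u` (relative to the fixed subspace `y`). -/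
def SlashCovers (y u v : Submodule F V) : Prop :=
  Covers u v ∧ Module.finrank F ↥(v ⊓ y) = Module.finrank F ↥(u ⊓ y) + 1

/-- `v` backslash-covers `u` (relative to the fixed subspace `y`). -/
def BackslashCovers (y u v : Submodule F V) : Prop :=
  Covers u v ∧ Module.finrank F ↥(v ⊓ y) = Module.finrank F ↥(u ⊓ y)

/-- `q` raised to a real exponent, as a complex number. -/
def qpow (q : ℕ) (e : ℝ) : ℂ := (((q : ℝ) ^ e : ℝ) : ℂ)

/-- The Gaussian bracket `[m] = (q^m - 1)/(q - 1)` as a rational number. -/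
def gaussQ (q m : ℕ) : ℚ := ((q : ℚ) ^ m - 1) / ((q : ℚ) - 1)

/-- The Gaussian bracket `[m] = (q^m - 1)/(q - 1)` as a complex number. -/
def gaussC (q m : ℕ) : ℂ := ((q : ℂ) ^ m - 1) / ((q : ℂ) - 1)

/-- The diagonal matrix `K1`; the `(u,u)` entry is `q^(k/2 - i)` for `u ∈ P_{i,j}`. -/
def matK1 (q k : ℕ) (y : Submodule F V) : Matrix (Submodule F V) (Submodule F V) ℂ :=
  Matrix.diagonal fun u => qpow q ((k : ℝ) / 2 - (Module.finrank F ↥(u ⊓ y) : ℝ))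

/-- The diagonal matrix `K2`; the `(u,u)` entry is `q^(j - (n-k)/2)` for `u ∈ P_{i,j}`. -/
def matK2 (q n k : ℕ) (y : Submodule F V) : Matrix (Submodule F V) (Submodule F V) ℂ :=
  Matrix.diagonal fun u =>
    qpow q (((Module.finrank F ↥u : ℝ) - (Module.finrank F ↥(u ⊓ y) : ℝ))
      - ((n : ℝ) - (k : ℝ)) / 2)

/-- The 0-1 matrix `L1`; the `(u,v)` entry is `1` iff `v` slash-covers `u`. -/
def matL1 (y : Submodule F V) : Matrix (Submodule F V) (Submodule F V) ℂ :=
  Matrix.of fun u v => if SlashCovers y u v then (1 : ℂ) else 0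

/-- The 0-1 matrix `L2`; the `(u,v)` entry is `1` iff `v` backslash-covers `u`. -/
def matL2 (y : Submodule F V) : Matrix (Submodule F V) (Submodule F V) ℂ :=
  Matrix.of fun u v => if BackslashCovers y u v then (1 : ℂ) else 0

/-- `R1 = L1ᵀ`. -/
def matR1 (y : Submodule F V) : Matrix (Submodule F V) (Submodule F V) ℂ := Matrix.transpose (matL1 y)

/-- `R2 = L2ᵀ`. -/
def matR2 (y : Submodule F V) : Matrix (Submodule F V) (Submodule F V) ℂ := Matrix.transpose (matL2 y)

/-- `R = L1 · R2`. -/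
def matR [Fintype (Submodule F V)] (y : Submodule F V) :
    Matrix (Submodule F V) (Submodule F V) ℂ := matL1 y * matR2 y

/-- `L = R1 · L2`. -/
def matL [Fintype (Submodule F V)] (y : Submodule F V) :
    Matrix (Submodule F V) (Submodule F V) ℂ := matR1 y * matL2 y

/-- The 0-1 matrix `F0`. -/
def matF0 (y : Submodule F V) : Matrix (Submodule F V) (Submodule F V) ℂ :=
  Matrix.of fun u v =>
    if SlashCovers y u (u ⊔ v) ∧ SlashCovers y v (u ⊔ v) ∧
        BackslashCovers y (u ⊓ v) u ∧ BackslashCovers y (u ⊓ v) v then (1 : ℂ) else 0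

/-- The 0-1 matrix `F+`. -/
def matFp (y : Submodule F V) : Matrix (Submodule F V) (Submodule F V) ℂ :=
  Matrix.of fun u v =>
    if BackslashCovers y u (u ⊔ v) ∧ BackslashCovers y v (u ⊔ v) then (1 : ℂ) else 0

/-- The 0-1 matrix `F-`. -/
def matFm (y : Submodule F V) : Matrix (Submodule F V) (Submodule F V) ℂ :=
  Matrix.of fun u v =>
    if SlashCovers y (u ⊓ v) u ∧ SlashCovers y (u ⊓ v) v then (1 : ℂ) else 0

/-- The vertex set `X` of the Grassmann graph: `k`-dimensional subspaces of `V`. -/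
abbrev GrassVertex (F V : Type) [Field F] [AddCommGroup V] [Module F V] (k : ℕ) :=
  {z : Submodule F V // Module.finrank F ↥z = k}

/-- The Grassmann graph `J_q(n,k)`: vertices are adjacent iff their intersection
has dimension `k - 1`. -/
def Grass (F V : Type) [Field F] [AddCommGroup V] [Module F V] (k : ℕ) :
    SimpleGraph (GrassVertex F V k) :=
  SimpleGraph.fromRel fun a b => Module.finrank F ↥(a.1 ⊓ b.1) = k - 1

/-- `B_xy = {z ∈ Γ(x) : ∂(z,y) = ∂(x,y) + 1}`. -/
def Bset {k : ℕ} (x y : GrassVertex F V k) : Set (GrassVertex F V k) :=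
  {z | (Grass F V k).Adj x z ∧ (Grass F V k).dist z y = (Grass F V k).dist x y + 1}

/-- `C_xy = {z ∈ Γ(x) : ∂(z,y) = ∂(x,y) - 1}`. -/
def Cset {k : ℕ} (x y : GrassVertex F V k) : Set (GrassVertex F V k) :=
  {z | (Grass F V k).Adj x z ∧ (Grass F V k).dist z y = (Grass F V k).dist x y - 1}

/-- `A_xy = {z ∈ Γ(x) : ∂(z,y) = ∂(x,y)}`. -/
def Aset {k : ℕ} (x y : GrassVertex F V k) : Set (GrassVertex F V k) :=
  {z | (Grass F V k).Adj x z ∧ (Grass F V k).dist z y = (Grass F V k).dist x y}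

/-- `A0_xy`. -/
def A0set {k : ℕ} (x y : GrassVertex F V k) : Set (GrassVertex F V k) :=
  {z | (Grass F V k).Adj x z ∧
    SlashCovers y.1 z.1 (z.1 ⊔ x.1) ∧ SlashCovers y.1 x.1 (z.1 ⊔ x.1) ∧
    BackslashCovers y.1 (z.1 ⊓ x.1) z.1 ∧ BackslashCovers y.1 (z.1 ⊓ x.1) x.1}

/-- `A+_xy`. -/
def Apset {k : ℕ} (x y : GrassVertex F V k) : Set (GrassVertex F V k) :=
  {z | (Grass F V k).Adj x z ∧
    BackslashCovers y.1 z.1 (z.1 ⊔ x.1) ∧ BackslashCovers y.1 x.1 (z.1 ⊔ x.1)}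

/-- `A-_xy`. -/
def Amset {k : ℕ} (x y : GrassVertex F V k) : Set (GrassVertex F V k) :=
  {z | (Grass F V k).Adj x z ∧
    SlashCovers y.1 (z.1 ⊓ x.1) z.1 ∧ SlashCovers y.1 (z.1 ⊓ x.1) x.1}

/-- The edge `wz` has type `0`. -/
def EdgeType0 {k : ℕ} (y w z : GrassVertex F V k) : Prop :=
  SlashCovers y.1 w.1 (w.1 ⊔ z.1) ∧ SlashCovers y.1 z.1 (w.1 ⊔ z.1) ∧
  BackslashCovers y.1 (w.1 ⊓ z.1) w.1 ∧ BackslashCovers y.1 (w.1 ⊓ z.1) z.1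

/-- The edge `wz` has type `+`. -/
def EdgeTypeP {k : ℕ} (y w z : GrassVertex F V k) : Prop :=
  BackslashCovers y.1 w.1 (w.1 ⊔ z.1) ∧ BackslashCovers y.1 z.1 (w.1 ⊔ z.1)

/-- The edge `wz` has type `-`. -/
def EdgeTypeM {k : ℕ} (y w z : GrassVertex F V k) : Prop :=
  SlashCovers y.1 (w.1 ⊓ z.1) w.1 ∧ SlashCovers y.1 (w.1 ⊓ z.1) z.1

/-- The hyperplanes of `U` that contain `A`. -/
def hyperplanesAbove [Fintype (Submodule F V)] (U A : Submodule F V) : Finset (Submodule F V) :=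
  Finset.univ.filter fun z => z ≤ U ∧ Module.finrank F z + 1 = Module.finrank F U ∧ A ≤ z

theorem mem_hyperplanesAbove [Fintype (Submodule F V)] {U A z : Submodule F V} :
    z ∈ hyperplanesAbove U A ↔ z ≤ U ∧ Module.finrank F z + 1 = Module.finrank F U ∧ A ≤ z := by
  simp [hyperplanesAbove]

theorem card_nonzero_dual_vanishing_add_one [Fintype F] [FiniteDimensional F V]
    [Fintype (Module.Dual F V)] (A : Submodule F V) :
    (Finset.univ.filter fun f : Module.Dual F V => f ≠ 0 ∧ A ≤ LinearMap.ker f).card + 1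
      = Fintype.card F ^ (Module.finrank F V - Module.finrank F A) := by
  have h1 : Module.finrank F A.dualAnnihilator = Module.finrank F V - Module.finrank F A := by
    have := Subspace.finrank_add_finrank_dualAnnihilator_eq A
    omega
  rw [← h1, ← Module.card_eq_pow_finrank (K := F) (V := A.dualAnnihilator),
    Fintype.card_subtype]
  have h2 : (Finset.univ.filter fun f : Module.Dual F V => f ≠ 0 ∧ A ≤ LinearMap.ker f)
      = (Finset.univ.filter fun f => f ∈ A.dualAnnihilator).erase 0 := by
    ext f
    simp [Submodule.mem_dualAnnihilator, SetLike.le_def]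
  rw [h2, Finset.card_erase_add_one]
  simp

theorem card_hyperplanesAbove [Fintype F] [FiniteDimensional F V] [Fintype (Submodule F V)]
    {U A : Submodule F V} (hA : A ≤ U) :
    (hyperplanesAbove U A).card * (Fintype.card F - 1) + 1
      = Fintype.card F ^ (Module.finrank F U - Module.finrank F A) := by
  have : Finite (Module.Dual F U) := Module.finite_of_finite F
  have : Fintype (Module.Dual F U) := Fintype.ofFinite _
  have hfin (B : Submodule F V) (hB : B ≤ U) :
      Module.finrank F (B.comap U.subtype) = Module.finrank F B := by
    rw [← Submodule.finrank_map_subtype_eq, Submodule.map_comap_subtype, inf_eq_right.mpr hB]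
  rw [← hfin A hA, ← card_nonzero_dual_vanishing_add_one]
  rw [Finset.card_eq_sum_card_fiberwise (t := hyperplanesAbove U A)
    (f := fun f => (LinearMap.ker f).map U.subtype)]
  · rw [Finset.sum_const_nat (m := Fintype.card F - 1)]
    intro z hz
    obtain ⟨hzU, hzd, hAz⟩ := mem_hyperplanesAbove.mp hz
    have hc := card_nonzero_dual_vanishing_add_one (z.comap U.subtype)
    rw [hfin z hzU, show Module.finrank F U - Module.finrank F z = 1 by omega, pow_one] at hc
    rw [← hc, Nat.add_sub_cancel, Finset.filter_filter]
    congr 1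
    ext f
    simp only [Finset.mem_filter, Finset.mem_univ, true_and]
    constructor
    · rintro ⟨⟨h0, -⟩, rfl⟩
      refine ⟨h0, ?_⟩
      rw [Submodule.comap_map_eq_of_injective U.injective_subtype]
    · rintro ⟨h0, hle⟩
      refine ⟨⟨h0, (Submodule.comap_mono hAz).trans hle⟩, ?_⟩
      have hk := Module.Dual.finrank_ker_add_one_of_ne_zero h0
      have : z.comap U.subtype = LinearMap.ker f :=
        Submodule.eq_of_le_of_finrank_eq hle (by rw [hfin z hzU]; omega)
      rw [← this, Submodule.map_comap_subtype, inf_eq_right.mpr hzU]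
  · intro f hf
    simp only [Finset.coe_filter, Finset.mem_univ, true_and, Set.mem_ofPred_eq] at hf
    have hk := Module.Dual.finrank_ker_add_one_of_ne_zero hf.1
    refine mem_hyperplanesAbove.mpr ⟨Submodule.map_subtype_le _ _, ?_, ?_⟩
    · rw [Submodule.finrank_map_subtype_eq]; exact hk
    · have := Submodule.map_mono (f := U.subtype) hf.2
      rwa [Submodule.map_comap_subtype, inf_eq_right.mpr hA] at this

theorem finrank_inf_le_of_covers [FiniteDimensional F V] {a b : Submodule F V} (h : Covers a b)
    (c : Submodule F V) : Module.finrank F ↥(b ⊓ c) ≤ Module.finrank F ↥(a ⊓ c) + 1 := by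
  have h1 := Submodule.finrank_sup_add_finrank_inf_eq a (b ⊓ c)
  have h2 : a ⊓ (b ⊓ c) = a ⊓ c := by rw [← inf_assoc, inf_eq_left.mpr h.1]
  have h3 := Submodule.finrank_mono (sup_le h.1 (inf_le_left : b ⊓ c ≤ b))
  have h4 := h.2
  rw [h2] at h1
  omega

theorem sup_eq_of_covers [FiniteDimensional F V] {a b u : Submodule F V} (ha : Covers a u)
    (hb : Covers b u) (hab : a ≠ b) : a ⊔ b = u := by
  refine Submodule.eq_of_le_of_finrank_le (sup_le ha.1 hb.1) ?_
  by_contra hlt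
  have h1 := ha.2
  have h2 := hb.2
  have h3 := Submodule.eq_of_le_of_finrank_le (le_sup_left : a ≤ a ⊔ b) (by omega)
  have h4 := Submodule.eq_of_le_of_finrank_le (le_sup_right : b ≤ a ⊔ b) (by omega)
  exact hab (h3.trans h4.symm)

theorem covers_inf_of_covers [FiniteDimensional F V] {a b u : Submodule F V} (ha : Covers a u)
    (hb : Covers b u) (hab : a ≠ b) : Covers (a ⊓ b) a := by
  refine ⟨inf_le_left, ?_⟩
  have h1 := Submodule.finrank_sup_add_finrank_inf_eq a b
  rw [sup_eq_of_covers ha hb hab] at h1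
  have := ha.2
  have := hb.2
  omega

theorem covers_sup_of_covers [FiniteDimensional F V] {a b : Submodule F V}
    (ha : Covers (a ⊓ b) a) (hb : Covers (a ⊓ b) b) :
    Covers a (a ⊔ b) ∧ Covers b (a ⊔ b) := by
  have h1 := Submodule.finrank_sup_add_finrank_inf_eq a b
  have := ha.2
  have := hb.2
  exact ⟨⟨le_sup_left, by omega⟩, ⟨le_sup_right, by omega⟩⟩

theorem Grass.adj_iff {k : ℕ} {x z : GrassVertex F V k} :
    (Grass F V k).Adj x z ↔ x ≠ z ∧ Module.finrank F ↥(x.1 ⊓ z.1) = k - 1 := by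
  rw [Grass, SimpleGraph.fromRel_adj, inf_comm z.1 x.1, or_self]

theorem Grass.le_finrank_inf_add_length [FiniteDimensional F V] {k : ℕ}
    {x y : GrassVertex F V k} (p : (Grass F V k).Walk x y) :
    k ≤ Module.finrank F ↥(x.1 ⊓ y.1) + p.length := by
  induction p with
  | nil => rename_i u; rw [inf_idem, u.2]; exact Nat.le_add_right _ _
  | @cons u v w h p ih =>
    obtain ⟨hne, hd⟩ := Grass.adj_iff.mp h
    have hu := u.2
    have hv := v.2
    have hk : k ≠ 0 := by
      rintro rfl
      exact hne (Subtype.ext ((Submodule.finrank_eq_zero.mp hu).trans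
        (Submodule.finrank_eq_zero.mp hv).symm))
    have hc : Covers (u.1 ⊓ v.1) v.1 := ⟨inf_le_right, by omega⟩
    have h1 := finrank_inf_le_of_covers hc w.1
    have h2 : Module.finrank F ↥(u.1 ⊓ v.1 ⊓ w.1) ≤ Module.finrank F ↥(u.1 ⊓ w.1) :=
      Submodule.finrank_mono (inf_le_inf_right _ inf_le_left)
    rw [SimpleGraph.Walk.length_cons]
    omega

theorem Grass.exists_walk_length_le [Fintype F] [FiniteDimensional F V]
    [Fintype (Submodule F V)] {k : ℕ} (y : GrassVertex F V k) (m : ℕ) :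
    ∀ x : GrassVertex F V k, k ≤ Module.finrank F ↥(x.1 ⊓ y.1) + m →
      ∃ p : (Grass F V k).Walk x y, p.length ≤ m := by
  induction m with
  | zero =>
    intro x h
    have hx := x.2
    have hy := y.2
    have h1 : x.1 ⊓ y.1 = x.1 := Submodule.eq_of_le_of_finrank_le inf_le_left (by omega)
    have h2 : x = y :=
      Subtype.ext (Submodule.eq_of_le_of_finrank_eq (inf_eq_left.mp h1) (by omega))
    subst h2
    exact ⟨.nil, le_rfl⟩
  | succ m ih =>
    intro x h
    have hx := x.2
    have hy := y.2
    by_cases hxy : x.1 = y.1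
    · obtain rfl := Subtype.ext hxy
      exact ⟨.nil, by simp⟩
    have hnyx : ¬ y.1 ≤ x.1 := fun hle =>
      hxy (Submodule.eq_of_le_of_finrank_eq hle (by omega)).symm
    obtain ⟨v, hvy, hvx⟩ := SetLike.not_le_iff_exists.mp hnyx
    have hlt : Module.finrank F ↥(x.1 ⊓ y.1) < Module.finrank F x.1 := by
      refine Submodule.finrank_lt_finrank_of_lt (lt_of_le_of_ne inf_le_left fun he => hxy ?_)
      exact Submodule.eq_of_le_of_finrank_eq (inf_eq_left.mp he) (by omega)
    obtain ⟨H, hH⟩ : (hyperplanesAbove x.1 (x.1 ⊓ y.1)).Nonempty := by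
      rw [Finset.nonempty_iff_ne_empty]
      intro he
      have hc := card_hyperplanesAbove (inf_le_left : x.1 ⊓ y.1 ≤ x.1)
      rw [he, Finset.card_empty, zero_mul, zero_add] at hc
      have := Nat.one_lt_pow (Nat.sub_ne_zero_of_lt hlt) (Fintype.one_lt_card (α := F))
      omega
    obtain ⟨hHx, hHd, hHy⟩ := mem_hyperplanesAbove.mp hH
    have hvH : v ∉ H := fun hv => hvx (hHx hv)
    have hzd : Module.finrank F ↥(H ⊔ F ∙ v) = k := by
      rw [Submodule.finrank_sup_span_singleton hvH]
      omega
    have hvz : v ∈ H ⊔ F ∙ v := Submodule.mem_sup_right (Submodule.mem_span_singleton_self v)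
    have hadj : (Grass F V k).Adj x ⟨H ⊔ F ∙ v, hzd⟩ := by
      refine Grass.adj_iff.mpr ⟨fun he => hvx ?_, ?_⟩
      · rw [he]; exact hvz
      · have h1 := Submodule.finrank_mono (le_inf hHx (le_sup_left : H ≤ H ⊔ F ∙ v))
        have h2 : Module.finrank F ↥(x.1 ⊓ (H ⊔ F ∙ v)) < Module.finrank F ↥(H ⊔ F ∙ v) := by
          refine Submodule.finrank_lt_finrank_of_lt (lt_of_le_of_ne inf_le_right fun he => hvx ?_)
          exact inf_eq_right.mp he hvz
        simp only
        omega
    have hle : Module.finrank F ↥(x.1 ⊓ y.1) + 1 ≤ Module.finrank F ↥((H ⊔ F ∙ v) ⊓ y.1) := by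
      rw [← Submodule.finrank_sup_span_singleton (fun hv => hvx hv.1 : v ∉ x.1 ⊓ y.1)]
      refine Submodule.finrank_mono (sup_le (le_inf (hHy.trans le_sup_left) inf_le_right) ?_)
      rw [Submodule.span_singleton_le_iff_mem]
      exact ⟨hvz, hvy⟩
    obtain ⟨p, hp⟩ := ih ⟨H ⊔ F ∙ v, hzd⟩ (by simp only; omega)
    exact ⟨.cons hadj p, by rw [SimpleGraph.Walk.length_cons]; omega⟩

theorem Grass.finrank_inf_add_dist [Fintype F] [FiniteDimensional F V]
    [Fintype (Submodule F V)] {k : ℕ} (x y : GrassVertex F V k) :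
    Module.finrank F ↥(x.1 ⊓ y.1) + (Grass F V k).dist x y = k := by
  have hx := x.2
  have hle := Submodule.finrank_mono (inf_le_left : x.1 ⊓ y.1 ≤ x.1)
  obtain ⟨p, hp⟩ := Grass.exists_walk_length_le y (k - Module.finrank F ↥(x.1 ⊓ y.1)) x (by omega)
  have h1 := SimpleGraph.dist_le p
  obtain ⟨p', hp'⟩ := p.reachable.exists_walk_length_eq_dist
  have h2 := Grass.le_finrank_inf_add_length p'
  omega

theorem inf_eq_of_backslashCovers [FiniteDimensional F V] {y u v : Submodule F V}
    (h : BackslashCovers y u v) : v ⊓ y = u ⊓ y :=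
  (Submodule.eq_of_le_of_finrank_eq (inf_le_inf_right y h.1.1) h.2.symm).symm

/-- The combinatorial relation whose 0-1 matrix is `F0`. -/
def RelZero (y u v : Submodule F V) : Prop :=
  SlashCovers y u (u ⊔ v) ∧ SlashCovers y v (u ⊔ v) ∧
    BackslashCovers y (u ⊓ v) u ∧ BackslashCovers y (u ⊓ v) v

/-- The combinatorial relation whose 0-1 matrix is `F-`. -/
def RelMinus (y u v : Submodule F V) : Prop :=
  SlashCovers y (u ⊓ v) u ∧ SlashCovers y (u ⊓ v) v

theorem RelZero.inf_eq [FiniteDimensional F V] {y u v : Submodule F V} (h : RelZero y u v) :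
    u ⊓ y = v ⊓ y :=
  (inf_eq_of_backslashCovers h.2.2.1).trans (inf_eq_of_backslashCovers h.2.2.2).symm

theorem RelMinus.not_inf_le {y u v : Submodule F V} [FiniteDimensional F V]
    (h : RelMinus y u v) : ¬ u ⊓ y ≤ v := by
  intro hle
  have h1 := h.1.2
  have h2 := Submodule.finrank_mono
    (le_inf (le_inf inf_le_left hle) inf_le_right : u ⊓ y ≤ u ⊓ v ⊓ y)
  omega

theorem RelMinus.symm {y u v : Submodule F V} (h : RelMinus y u v) : RelMinus y v u := by
  unfold RelMinus at *
  rw [inf_comm]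
  exact h.symm

/-- If `z` meets both `w` and `x` in codimension one but does not contain `w ⊓ x`,
then `z` lies in `w ⊔ x`. -/
theorem le_sup_of_covers [FiniteDimensional F V] {w x z : Submodule F V}
    (hwx : Covers (w ⊓ x) w) (hw : Covers (w ⊓ z) w) (hwz : Covers (w ⊓ z) z)
    (hxz : Covers (z ⊓ x) z) (hn : ¬ w ⊓ x ≤ z) : z ≤ w ⊔ x := by
  have hne : w ⊓ z ≠ z ⊓ x := by
    intro he
    have h1 : w ⊓ z ≤ w ⊓ x := le_inf inf_le_left (he.le.trans inf_le_right)
    have h2 := Submodule.eq_of_le_of_finrank_eq h1 (by have := hwx.2; have := hw.2; omega)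
    exact hn (h2 ▸ inf_le_right)
  rw [← sup_eq_of_covers hwz hxz hne]
  exact sup_le_sup inf_le_left inf_le_right

theorem relMinus_of_covers [FiniteDimensional F V] {y u v t : Submodule F V} (hu : Covers u t)
    (hv : Covers v t) (hd : Module.finrank F ↥(u ⊓ y) = Module.finrank F ↥(v ⊓ y))
    (hn : ¬ u ⊓ y ≤ v) : RelMinus y u v := by
  have hne : u ≠ v := fun he => hn (he ▸ inf_le_left)
  have h1 := covers_inf_of_covers hu hv hne
  have h2 := covers_inf_of_covers hv hu hne.symm
  rw [inf_comm] at h2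
  have h3 := finrank_inf_le_of_covers h1 y
  have h4 : Module.finrank F ↥(u ⊓ v ⊓ y) < Module.finrank F ↥(u ⊓ y) := by
    refine Submodule.finrank_lt_finrank_of_lt
      (lt_of_le_of_ne (inf_le_inf_right y inf_le_left) fun he => hn ?_)
    rw [← he]
    exact inf_le_left.trans inf_le_right
  exact ⟨⟨h1, by omega⟩, ⟨h2, by omega⟩⟩

theorem relMinus_relMinus_iff [FiniteDimensional F V] {y w x z : Submodule F V}
    (h : RelZero y w x) :
    RelMinus y w z ∧ RelMinus y z x ↔
      z ≤ w ⊔ x ∧ Module.finrank F z + 1 = Module.finrank F ↥(w ⊔ x) ∧ ¬ w ⊓ y ≤ z := by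
  have hyx := h.inf_eq
  have hHy := inf_eq_of_backslashCovers h.2.2.1
  constructor
  · rintro ⟨h1, h2⟩
    have hn := h1.not_inf_le
    refine ⟨le_sup_of_covers h.2.2.1.1 h1.1.1 h1.2.1 h2.1.1 fun hle => hn ?_, ?_, hn⟩
    · rw [hHy]
      exact inf_le_left.trans hle
    · have := h1.1.1.2
      have := h1.2.1.2
      have := h.1.1.2
      omega
  · rintro ⟨hle, hd, hn⟩
    have hz : Covers z (w ⊔ x) := ⟨hle, hd.symm⟩
    have hge := finrank_inf_le_of_covers hz y
    have hw := h.1.2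
    have hlt : Module.finrank F ↥(z ⊓ y) < Module.finrank F ↥((w ⊔ x) ⊓ y) := by
      refine Submodule.finrank_lt_finrank_of_lt
        (lt_of_le_of_ne (inf_le_inf_right y hle) fun he => hn ?_)
      exact (inf_le_inf_right y le_sup_left).trans (he ▸ inf_le_left)
    refine ⟨relMinus_of_covers h.1.1 hz (by omega) hn,
      (relMinus_of_covers h.2.1.1 hz ?_ (hyx ▸ hn)).symm⟩
    rw [← hyx]
    omega

theorem finrank_sup_inf_of_relMinus [FiniteDimensional F V] {y w x : Submodule F V}
    (h : RelMinus y w x) :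
    Module.finrank F ↥((w ⊔ x) ⊓ y) = Module.finrank F ↥(w ⊓ y) + 1 := by
  have hc := (covers_sup_of_covers h.1.1 h.2.1).1
  have hge := finrank_inf_le_of_covers hc y
  have hlt : Module.finrank F ↥(w ⊓ y) < Module.finrank F ↥((w ⊔ x) ⊓ y) := by
    refine Submodule.finrank_lt_finrank_of_lt
      (lt_of_le_of_ne (inf_le_inf_right y le_sup_left) fun he => h.symm.not_inf_le ?_)
    exact (inf_le_inf_right y le_sup_right).trans (he ▸ inf_le_left)
  omega

theorem relZero_relMinus_iff [FiniteDimensional F V] {y w x z : Submodule F V}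
    (h : RelMinus y w x) :
    RelZero y w z ∧ RelMinus y z x ↔
      (z ≤ w ⊔ x ∧ Module.finrank F z + 1 = Module.finrank F ↥(w ⊔ x) ∧ w ⊓ y ≤ z) ∧
        ¬ (w ⊔ x) ⊓ y ≤ z ∧ z ≠ w := by
  obtain ⟨hcw, hcx⟩ := covers_sup_of_covers h.1.1 h.2.1
  have hU := finrank_sup_inf_of_relMinus h
  constructor
  · rintro ⟨h1, h2⟩
    have hzw := h1.inf_eq
    have hne : z ≠ w := by
      rintro rfl
      have := h1.1.1.2
      rw [sup_idem] at this
      omega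
    have hwz : w ⊓ y ≤ z := hzw ▸ inf_le_left
    have hd : Module.finrank F z = Module.finrank F w := by
      have := h1.1.1.2
      have := h1.2.1.1.2
      omega
    have hn : ¬ w ⊓ x ≤ z := by
      intro hle
      have hne' : w ⊓ x ≠ w ⊓ z := by
        intro he
        have : w ⊓ y ≤ w ⊓ x := he ▸ le_inf inf_le_left hwz
        exact h.not_inf_le (this.trans inf_le_right)
      have hw := sup_eq_of_covers h.1.1 h1.2.2.1.1 hne'
      have : w ≤ z := hw ▸ sup_le hle inf_le_right
      exact hne (Submodule.eq_of_le_of_finrank_eq this hd.symm).symm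
    refine ⟨⟨le_sup_of_covers h.1.1 h1.2.2.1.1 h1.2.2.2.1 h2.1.1 hn, ?_, hwz⟩, ?_, hne⟩
    · rw [hd, hcw.2]
    · intro hle
      have h3 := Submodule.finrank_mono (le_inf hle inf_le_right)
      rw [← hzw] at h3
      omega
  · rintro ⟨⟨hle, hd, hwz⟩, hn, hne⟩
    have hz : Covers z (w ⊔ x) := ⟨hle, hd.symm⟩
    have hge := finrank_inf_le_of_covers hz y
    have hlt : Module.finrank F ↥(z ⊓ y) < Module.finrank F ↥((w ⊔ x) ⊓ y) := by
      refine Submodule.finrank_lt_finrank_of_lt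
        (lt_of_le_of_ne (inf_le_inf_right y hle) fun he => hn ?_)
      exact he ▸ inf_le_left
    have hzy : w ⊓ y = z ⊓ y :=
      Submodule.eq_of_le_of_finrank_le (le_inf hwz inf_le_right) (by omega)
    have hs := sup_eq_of_covers hcw hz hne.symm
    have hwzy : w ⊓ z ⊓ y = w ⊓ y :=
      le_antisymm (inf_le_inf_right y inf_le_left) (le_inf (le_inf inf_le_left hwz) inf_le_right)
    have hc1 := covers_inf_of_covers hcw hz hne.symm
    have hc2 := covers_inf_of_covers hz hcw hne
    rw [inf_comm] at hc2
    refine ⟨⟨⟨hs ▸ hcw, by rw [hs, hU]⟩, ⟨hs ▸ hz, by rw [hs, hU, hzy]⟩,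
      ⟨hc1, by rw [hwzy]⟩, ⟨hc2, by rw [hwzy, hzy]⟩⟩, ?_⟩
    refine relMinus_of_covers hz hcx ?_ (hzy ▸ h.not_inf_le)
    rw [← hzy, h.1.2, h.2.2]

theorem mul_apply_eq_card {ι : Type*} [Fintype ι] (A B : Matrix ι ι ℂ) (r s : ι → ι → Prop)
    (hA : ∀ a b, A a b = if r a b then 1 else 0) (hB : ∀ a b, B a b = if s a b then 1 else 0)
    (a c : ι) : (A * B) a c = ((Finset.univ.filter fun b => r a b ∧ s b c).card : ℂ) := by
  simp only [Matrix.mul_apply, hA, hB, Finset.card_filter, Nat.cast_sum, Nat.cast_ite,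
    Nat.cast_one, Nat.cast_zero, ite_and]
  refine Finset.sum_congr rfl fun b _ => ?_
  split_ifs <;> simp

theorem matF0_apply (y u v : Submodule F V) :
    matF0 y u v = if RelZero y u v then 1 else 0 :=
  if_congr Iff.rfl rfl rfl

theorem matFm_apply (y u v : Submodule F V) :
    matFm y u v = if RelMinus y u v then 1 else 0 :=
  if_congr Iff.rfl rfl rfl

theorem matF0_mul_matFm_apply_of_relZero [FiniteDimensional F V] [Fintype (Submodule F V)]
    {y w x : Submodule F V} (h : RelZero y w x) : (matF0 y * matFm y) w x = 0 := by
  rw [mul_apply_eq_card _ _ _ _ (matF0_apply y) (matFm_apply y), Nat.cast_eq_zero,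
    Finset.card_eq_zero, Finset.filter_eq_empty_iff]
  rintro z - ⟨h1, h2⟩
  refine h2.not_inf_le ?_
  rw [← h1.inf_eq, h.inf_eq]
  exact inf_le_left

theorem matF0_mul_matF0_apply_of_relMinus [FiniteDimensional F V] [Fintype (Submodule F V)]
    {y w x : Submodule F V} (h : RelMinus y w x) : (matF0 y * matF0 y) w x = 0 := by
  rw [mul_apply_eq_card _ _ _ _ (matF0_apply y) (matF0_apply y), Nat.cast_eq_zero,
    Finset.card_eq_zero, Finset.filter_eq_empty_iff]
  rintro z - ⟨h1, h2⟩
  refine h.not_inf_le ?_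
  rw [h1.inf_eq, h2.inf_eq]
  exact inf_le_left

theorem card_hyperplanesAbove_complex [Fintype F] [FiniteDimensional F V]
    [Fintype (Submodule F V)] {U A : Submodule F V} (hA : A ≤ U) :
    ((hyperplanesAbove U A).card : ℂ) * ((Fintype.card F : ℂ) - 1) + 1
      = (Fintype.card F : ℂ) ^ (Module.finrank F U - Module.finrank F A) := by
  rw [← Nat.cast_pow, ← card_hyperplanesAbove hA]
  push_cast [Nat.cast_sub (Fintype.card_pos (α := F))]
  simp

theorem matFm_mul_matFm_apply_of_relZero [Fintype F] [FiniteDimensional F V]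
    [Fintype (Submodule F V)] {y w x : Submodule F V} (h : RelZero y w x) :
    (matFm y * matFm y) w x * ((Fintype.card F : ℂ) - 1)
      = (Fintype.card F : ℂ) ^ (Module.finrank F w + 1)
        - (Fintype.card F : ℂ) ^ (Module.finrank F w + 1 - Module.finrank F ↥(w ⊓ y)) := by
  rw [mul_apply_eq_card _ _ _ _ (matFm_apply y) (matFm_apply y)]
  have hS : (Finset.univ.filter fun z => RelMinus y w z ∧ RelMinus y z x)
      = hyperplanesAbove (w ⊔ x) ⊥ \ hyperplanesAbove (w ⊔ x) (w ⊓ y) := by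
    ext z
    simp only [Finset.mem_filter, Finset.mem_univ, true_and, Finset.mem_sdiff,
      mem_hyperplanesAbove, relMinus_relMinus_iff h, bot_le]
    tauto
  have hsub : hyperplanesAbove (w ⊔ x) (w ⊓ y) ⊆ hyperplanesAbove (w ⊔ x) ⊥ := fun z hz =>
    have hz := mem_hyperplanesAbove.mp hz
    mem_hyperplanesAbove.mpr ⟨hz.1, hz.2.1, bot_le⟩
  have h1 := card_hyperplanesAbove_complex (bot_le : ⊥ ≤ w ⊔ x)
  have h2 := card_hyperplanesAbove_complex (inf_le_left.trans le_sup_left : w ⊓ y ≤ w ⊔ x)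
  rw [h.1.1.2] at h1 h2
  rw [finrank_bot, Nat.sub_zero] at h1
  rw [hS, Finset.cast_card_sdiff hsub, ← h1, ← h2]
  ring

theorem matF0_mul_matFm_apply_of_relMinus [Fintype F] [FiniteDimensional F V]
    [Fintype (Submodule F V)] {y w x : Submodule F V} (h : RelMinus y w x) :
    (matF0 y * matFm y) w x
      = (Fintype.card F : ℂ) ^ (Module.finrank F w - Module.finrank F ↥(w ⊓ y)) - 1 := by
  rw [mul_apply_eq_card _ _ _ _ (matF0_apply y) (matFm_apply y)]
  have hU := finrank_sup_inf_of_relMinus h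
  have hc := (covers_sup_of_covers h.1.1 h.2.1).1
  have hS : (Finset.univ.filter fun z => RelZero y w z ∧ RelMinus y z x)
      = (hyperplanesAbove (w ⊔ x) (w ⊓ y) \ hyperplanesAbove (w ⊔ x) ((w ⊔ x) ⊓ y)).erase w := by
    ext z
    simp only [Finset.mem_filter, Finset.mem_univ, true_and, Finset.mem_sdiff,
      mem_hyperplanesAbove, relZero_relMinus_iff h, Finset.mem_erase]
    tauto
  have hsub : hyperplanesAbove (w ⊔ x) ((w ⊔ x) ⊓ y) ⊆ hyperplanesAbove (w ⊔ x) (w ⊓ y) :=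
    fun z hz =>
      have hz := mem_hyperplanesAbove.mp hz
      mem_hyperplanesAbove.mpr
        ⟨hz.1, hz.2.1, (inf_le_inf_right y le_sup_left).trans hz.2.2⟩
  have hw : w ∈ hyperplanesAbove (w ⊔ x) (w ⊓ y) \ hyperplanesAbove (w ⊔ x) ((w ⊔ x) ⊓ y) := by
    simp only [Finset.mem_sdiff, mem_hyperplanesAbove]
    refine ⟨⟨hc.1, hc.2.symm, inf_le_left⟩, fun hle => ?_⟩
    have := Submodule.finrank_mono (le_inf hle.2.2 inf_le_right)
    omega
  have hle := Submodule.finrank_mono (inf_le_left : w ⊓ y ≤ w)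
  have h1 := card_hyperplanesAbove_complex (inf_le_left : (w ⊔ x) ⊓ y ≤ w ⊔ x)
  have h2 := card_hyperplanesAbove_complex (inf_le_left.trans le_sup_left : w ⊓ y ≤ w ⊔ x)
  rw [hc.2, hU, Nat.add_sub_add_right] at h1
  rw [hc.2, Nat.sub_add_comm hle, pow_succ] at h2
  have hq : (Fintype.card F : ℂ) - 1 ≠ 0 := by
    rw [sub_ne_zero]
    exact_mod_cast (Fintype.one_lt_card (α := F)).ne'
  rw [hS, Finset.cast_card_erase_of_mem hw, Finset.cast_card_sdiff hsub]
  congr 1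
  apply mul_right_cancel₀ hq
  linear_combination h2 - h1

theorem statement14
    (q n k : ℕ) (hq : IsPrimePow q) (hkn : 2 * k < n) (hk : 3 ≤ k)
    (F V : Type) [Field F] [Fintype F] (hcard : Fintype.card F = q)
    [AddCommGroup V] [Module F V] [FiniteDimensional F V]
    (hdim : Module.finrank F V = n)
    [Fintype (Submodule F V)]
    (x y : GrassVertex F V k)
    (i : ℕ) (hi : (Grass F V k).dist x y = i) (hi1 : 1 < i) (hi2 : i < k) :
    ∀ w ∈ A0set x y, ∀ w' ∈ Amset x y,
      ((q : ℂ) - 1) * gaussC q i * (matF0 y.1 * matFm y.1) w.1 x.1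
        = (q : ℂ) ^ (i + 1) * gaussC q (k - i) * (matF0 y.1 * matF0 y.1) w'.1 x.1 ∧
      ((q : ℂ) - 1) * gaussC q i * (matFm y.1 * matFm y.1) w.1 x.1
        = (q : ℂ) ^ (i + 1) * gaussC q (k - i) * (matF0 y.1 * matFm y.1) w'.1 x.1 := by
  intro w hw w' hw'
  have h0 : RelZero y.1 w.1 x.1 := hw.2
  have hm : RelMinus y.1 w'.1 x.1 := hw'.2
  refine ⟨by rw [matF0_mul_matFm_apply_of_relZero h0, matF0_mul_matF0_apply_of_relMinus hm,
    mul_zero, mul_zero], ?_⟩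
  have hd := Grass.finrank_inf_add_dist x y
  rw [hi] at hd
  have hwy : Module.finrank F ↥(w.1 ⊓ y.1) = k - i := by
    rw [h0.inf_eq]
    omega
  have hwy' : Module.finrank F ↥(w'.1 ⊓ y.1) = k - i := by
    rw [hm.1.2, ← hm.2.2]
    omega
  have h1 := matFm_mul_matFm_apply_of_relZero h0
  have h2 := matF0_mul_matFm_apply_of_relMinus hm
  have hq1 : (q : ℂ) - 1 ≠ 0 := by
    rw [sub_ne_zero]
    exact_mod_cast hq.one_lt.ne'
  rw [hcard, w.2, hwy, show k + 1 - (k - i) = i + 1 by omega,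
    show k + 1 = (i + 1) + (k - i) by omega, pow_add _ (i + 1) (k - i)] at h1
  rw [hcard, w'.2, hwy', show k - (k - i) = i by omega] at h2
  rw [h2, gaussC, gaussC]
  field_simp
  linear_combination ((q : ℂ) ^ i - 1) * h1
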